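/- Let $(S,\Sigma)$ be a measurable space, $\{\mu^{(n)}\}$ finite measures converging in total variation to $\mu$, and $\tilde{\mu}, \tilde{\mu}^{(n)}$ finite signed measures with $\tilde{\mu} \ll \mu$ and $\tilde{\mu}^{(n)} \ll \mu^{(n)}$. Then $\liminf_{n\to\infty}\inf_{A\in\Sigma}(\tilde{\mu}^{(n)}(A) - \tilde{\mu}(A)) \ge 0$ if and only if: (i) for each $\varepsilon>0$, $\mu(\{s: \frac{d\tilde{\mu}^{(n)}}{d\mu^{(n)}}(s) \le \frac{d\tilde{\mu}}{d\mu}(s)-\varepsilon\}) \to 0$; and (ii) $\liminf_{K\to+\infty}\inf_{n\ge1}\tilde{\mu}^{(n)}(\{s: \frac{d\tilde{\mu}^{(n)}}{d\mu^{(n)}}(s) \le -K\}) \ge 0$. -/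

import Mathlib

open MeasureTheory Filter Topology

section Auxiliary

variable {S : Type*} [MeasurableSpace S] {μ ν : Measure S} {f g : S → ℝ}

/-- Absolute continuity of the integral, in `ε`-`δ` form. -/
lemma exists_pos_abs_setIntegral_lt [IsFiniteMeasure μ] (hf : Integrable f μ) {ε : ℝ}
    (hε : 0 < ε) : ∃ δ > 0, ∀ A, μ.real A < δ → |∫ x in A, f x ∂μ| < ε := by
  have hμ : Tendsto (fun A : Set S => μ A) (comap μ.real (𝓝 0)) (𝓝 0) := by
    rw [← ENNReal.tendsto_toReal_iff (fun A => measure_ne_top μ A) ENNReal.zero_ne_top]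
    exact tendsto_comap
  have h := hf.tendsto_setIntegral_nhds_zero (s := fun A : Set S => A) hμ
  have h2 := h.eventually (Metric.ball_mem_nhds (0 : ℝ) hε)
  rw [eventually_comap] at h2
  obtain ⟨δ, hδ, H⟩ := Metric.eventually_nhds_iff.1 h2
  refine ⟨δ, hδ, fun A hA => ?_⟩
  have := H (y := μ.real A) (by simpa [abs_of_nonneg measureReal_nonneg] using hA) A rfl
  simpa using this

lemma abs_setIntegral_le_integral_abs (hf : Integrable f μ) (A : Set S) :
    |∫ x in A, f x ∂μ| ≤ ∫ x, |f x| ∂μ :=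
  abs_integral_le_integral_abs.trans
    (setIntegral_le_integral hf.abs (ae_of_all _ fun _ => abs_nonneg _))

lemma eventually_measureReal_lt_abs_lt [IsFiniteMeasure μ] (hf : Integrable f μ) {δ : ℝ}
    (hδ : 0 < δ) : ∀ᶠ M : ℝ in atTop, μ.real {x | M < |f x|} < δ := by
  filter_upwards [eventually_gt_atTop ((∫ x, |f x| ∂μ) / δ), eventually_gt_atTop 0] with M hM hM0
  have h := mul_meas_ge_le_integral_of_nonneg (ae_of_all μ fun x => abs_nonneg (f x)) hf.abs M
  have h2 : μ.real {x | M < |f x|} ≤ μ.real {x | M ≤ |f x|} :=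
    measureReal_mono (Set.ofPred_subset_ofPred.2 fun x hx => hx.le)
  rw [div_lt_iff₀ hδ] at hM
  by_contra! h3
  nlinarith

lemma mul_measureReal_le_neg_setIntegral [IsFiniteMeasure μ] (hf : Integrable f μ)
    (hfm : Measurable f) (K : ℝ) :
    K * μ.real {x | f x ≤ -K} ≤ -∫ x in {x | f x ≤ -K}, f x ∂μ := by
  have h := setIntegral_mono_on (μ := μ) (f := f) (g := fun _ => -K) (s := {x | f x ≤ -K})
    hf.integrableOn (integrable_const _).integrableOn (measurableSet_le hfm measurable_const)
    fun x hx => hx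
  rw [setIntegral_const, smul_eq_mul] at h
  linarith

lemma eventually_neg_le_setIntegral_sublevel [IsFiniteMeasure μ] (hf : Integrable f μ)
    {ε : ℝ} (hε : 0 < ε) : ∀ᶠ K : ℝ in atTop, -ε ≤ ∫ x in {x | f x ≤ -K}, f x ∂μ := by
  obtain ⟨δ, hδ, H⟩ := exists_pos_abs_setIntegral_lt hf hε
  have h := (tendsto_atTop_add_const_right atTop (-1 : ℝ) tendsto_id).eventually
    (eventually_measureReal_lt_abs_lt hf hδ)
  filter_upwards [h] with K hK
  refine (abs_lt.1 (H _ (lt_of_le_of_lt (measureReal_mono fun x hx => ?_) hK))).1.le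
  have h1 : f x ≤ -K := hx
  have h2 := neg_abs_le (f x)
  have h3 := neg_le_abs (f x)
  simp only [id, Set.mem_ofPred_eq]
  linarith

lemma abs_setIntegral_sub_le_of_restrict_le [IsFiniteMeasure μ] [IsFiniteMeasure ν] {A : Set S}
    (hA : MeasurableSet A) (hle : ν.restrict A ≤ μ.restrict A) (hg : Measurable g) {M : ℝ}
    (hM : ∀ x ∈ A, |g x| ≤ M) :
    |∫ x in A, g x ∂μ - ∫ x in A, g x ∂ν| ≤ M * (μ.real A - ν.real A) := by
  have hgμ : IntegrableOn g A μ := Measure.integrableOn_of_bounded (measure_ne_top _ _)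
    hg.aestronglyMeasurable ((ae_restrict_mem hA).mono hM)
  have hgν : IntegrableOn g A ν := Measure.integrableOn_of_bounded (measure_ne_top _ _)
    hg.aestronglyMeasurable ((ae_restrict_mem hA).mono hM)
  have hcμ : IntegrableOn (fun _ => M) A μ := (integrable_const _).integrableOn
  have hcν : IntegrableOn (fun _ => M) A ν := (integrable_const _).integrableOn
  have h1 := integral_mono_measure (f := fun x => M - g x) hle
    ((ae_restrict_mem hA).mono fun x hx => by
      simpa using (abs_le.1 (hM x hx)).2) (hcμ.sub hgμ)
  have h2 := integral_mono_measure (f := fun x => M + g x) hle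
    ((ae_restrict_mem hA).mono fun x hx => by
      have := (abs_le.1 (hM x hx)).1
      simp only [Pi.zero_apply]; linarith) (hcμ.add hgμ)
  rw [integral_sub hcμ hgμ, integral_sub hcν hgν, setIntegral_const, setIntegral_const,
    smul_eq_mul, smul_eq_mul] at h1
  rw [integral_add hcμ hgμ, integral_add hcν hgν, setIntegral_const, setIntegral_const,
    smul_eq_mul, smul_eq_mul] at h2
  rw [abs_le]
  constructor <;> linarith

/-- Integrals of a bounded function against two measures that are setwise `d`-close. -/
lemma abs_setIntegral_sub_le [IsFiniteMeasure μ] [IsFiniteMeasure ν] {d : ℝ}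
    (hd : ∀ A, MeasurableSet A → |ν.real A - μ.real A| ≤ d) {A : Set S}
    (hA : MeasurableSet A) (hg : Measurable g) {M : ℝ} (hM0 : 0 ≤ M)
    (hM : ∀ x ∈ A, |g x| ≤ M) :
    |∫ x in A, g x ∂ν - ∫ x in A, g x ∂μ| ≤ 2 * M * d := by
  obtain ⟨P, hP⟩ := exists_isHahnDecomposition μ ν
  have hPm := hP.measurableSet
  have hgμ : IntegrableOn g A μ := Measure.integrableOn_of_bounded (measure_ne_top _ _)
    hg.aestronglyMeasurable ((ae_restrict_mem hA).mono hM)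
  have hgν : IntegrableOn g A ν := Measure.integrableOn_of_bounded (measure_ne_top _ _)
    hg.aestronglyMeasurable ((ae_restrict_mem hA).mono hM)
  have e1 : μ.restrict (A ∩ P) ≤ ν.restrict (A ∩ P) := by
    rw [← Measure.restrict_restrict hA, ← Measure.restrict_restrict hA]
    exact Measure.restrict_mono subset_rfl hP.le_on
  have e2 : ν.restrict (A \ P) ≤ μ.restrict (A \ P) := by
    rw [Set.sdiff_eq, ← Measure.restrict_restrict hA, ← Measure.restrict_restrict hA]
    exact Measure.restrict_mono subset_rfl hP.ge_on_compl
  have h1 := abs_setIntegral_sub_le_of_restrict_le (hA.inter hPm) e1 hg fun x hx => hM x hx.1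
  have h2 := abs_setIntegral_sub_le_of_restrict_le (hA.diff hPm) e2 hg fun x hx => hM x hx.1
  have d1 := mul_le_mul_of_nonneg_left (abs_le.1 (hd _ (hA.inter hPm))).2 hM0
  have d2 := mul_le_mul_of_nonneg_left (abs_le.1 (hd _ (hA.diff hPm))).1 hM0
  have i1 := integral_inter_add_sdiff hPm hgμ
  have i2 := integral_inter_add_sdiff hPm hgν
  rw [abs_le] at h1 h2 ⊢
  constructor <;> linarith [h1.1, h1.2, h2.1, h2.2]

lemma neg_le_iInf_measurableSet_iff {v : Set S → ℝ} {C : ℝ} (hC : ∀ A, -C ≤ v A) {ε : ℝ}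
    (hε : 0 ≤ ε) :
    (-ε ≤ ⨅ (A : Set S) (_ : MeasurableSet A), v A) ↔ ∀ A, MeasurableSet A → -ε ≤ v A := by
  have key (A : Set S) (c : ℝ) (hc : c ≤ 0) (h : MeasurableSet A → c ≤ v A) :
      c ≤ ⨅ (_ : MeasurableSet A), v A := by
    by_cases hA : MeasurableSet A
    · rw [ciInf_pos hA]; exact h hA
    · have : IsEmpty (MeasurableSet A) := ⟨hA⟩
      rw [Real.iInf_of_isEmpty]; exact hc
  constructor
  · intro h A hA
    have hb : BddBelow (Set.range fun A : Set S => ⨅ (_ : MeasurableSet A), v A) := by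
      refine ⟨-|C|, ?_⟩
      rintro _ ⟨B, rfl⟩
      exact key B _ (by simp) fun _ => (neg_le_neg (le_abs_self C)).trans (hC B)
    have := h.trans (ciInf_le hb A)
    rwa [ciInf_pos hA] at this
  · exact fun h => le_ciInf fun A => key A _ (by linarith) (h A)

/-- Convergence in total variation forces the limit of finite measures to be finite. -/
lemma isFiniteMeasure_of_tendsto_totalVariation {μs : ℕ → Measure S} [∀ n, IsFiniteMeasure (μs n)]
    (htv : Tendsto (fun n => ⨆ (A : Set S) (_ : MeasurableSet A),
      (μs n A - μ A) + (μ A - μs n A)) atTop (𝓝 0)) : IsFiniteMeasure μ := by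
  obtain ⟨n, hn⟩ := (htv.eventually (gt_mem_nhds ENNReal.zero_lt_top)).exists
  refine ⟨lt_top_iff_ne_top.2 fun h => hn.ne (top_le_iff.1 ?_)⟩
  refine le_trans ?_ (le_iSup₂ (f := fun (A : Set S) (_ : MeasurableSet A) =>
    (μs n A - μ A) + (μ A - μs n A)) Set.univ MeasurableSet.univ)
  simp [h, ENNReal.top_sub (measure_ne_top (μs n) Set.univ)]

lemma eventually_abs_measureReal_sub_le {μs : ℕ → Measure S} [∀ n, IsFiniteMeasure (μs n)]
    [IsFiniteMeasure μ]
    (htv : Tendsto (fun n => ⨆ (A : Set S) (_ : MeasurableSet A),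
      (μs n A - μ A) + (μ A - μs n A)) atTop (𝓝 0)) {d : ℝ} (hd : 0 < d) :
    ∀ᶠ n in atTop, ∀ A, MeasurableSet A → |(μs n).real A - μ.real A| ≤ d := by
  filter_upwards [htv.eventually (gt_mem_nhds (ENNReal.ofReal_pos.2 hd))] with n hn A hA
  have h := (le_iSup₂ (f := fun (A : Set S) (_ : MeasurableSet A) =>
    (μs n A - μ A) + (μ A - μs n A)) A hA).trans hn.le
  have h1 : μs n A ≤ ENNReal.ofReal d + μ A := tsub_le_iff_right.1 (le_self_add.trans h)
  have h2 : μ A ≤ ENNReal.ofReal d + μs n A := tsub_le_iff_right.1 (le_add_self.trans h)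
  have t1 := ENNReal.toReal_mono (by finiteness) h1
  have t2 := ENNReal.toReal_mono (by finiteness) h2
  rw [ENNReal.toReal_add (by finiteness) (by finiteness), ENNReal.toReal_ofReal hd.le] at t1 t2
  simp only [Measure.real]
  rw [abs_le]
  constructor <;> linarith

section Sequences

variable {μs : ℕ → Measure S} [∀ n, IsFiniteMeasure (μs n)] [IsFiniteMeasure μ] {F : ℕ → S → ℝ}

lemma tendsto_measure_of_eventually_setIntegral_sub_ge
    (htv : ∀ d : ℝ, 0 < d → ∀ᶠ n in atTop, ∀ A, MeasurableSet A →
      |(μs n).real A - μ.real A| ≤ d)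
    (hf : Integrable f μ) (hfm : Measurable f)
    (hF : ∀ n, Integrable (F n) (μs n)) (hFm : ∀ n, Measurable (F n))
    (h : ∀ ε : ℝ, 0 < ε → ∀ᶠ n in atTop, ∀ A, MeasurableSet A →
      -ε ≤ ∫ x in A, F n x ∂μs n - ∫ x in A, f x ∂μ) {ε : ℝ} (hε : 0 < ε) :
    Tendsto (fun n => μ {x | F n x ≤ f x - ε}) atTop (𝓝 0) := by
  rw [← ENNReal.tendsto_toReal_iff (fun n => measure_ne_top μ _) ENNReal.zero_ne_top,
    ENNReal.toReal_zero]
  rw [Metric.tendsto_nhds]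
  intro η hη
  obtain ⟨M, hM, hM0⟩ := ((eventually_measureReal_lt_abs_lt hf (half_pos hη)).and
    (eventually_ge_atTop 0)).exists
  have hMε : 0 < M + ε := by linarith
  filter_upwards [h (ε * η / 8) (by positivity),
    htv (ε * η / (16 * (M + ε))) (by positivity)] with n hn hd
  set B := {x | F n x ≤ f x - ε} with hB
  have hBm : MeasurableSet B := measurableSet_le (hFm n) (hfm.sub_const ε)
  set G := {x | M < |f x|} with hG
  have hGm : MeasurableSet G := measurableSet_lt measurable_const hfm.abs
  have hAm : MeasurableSet (B \ G) := hBm.diff hGm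
  have hfb : ∀ x ∈ B \ G, |f x| ≤ M := fun x hx => not_lt.1 hx.2
  have hgb : ∀ x ∈ B \ G, |f x - ε| ≤ M + ε := fun x hx => by
    have := abs_le.1 (hfb x hx)
    rw [abs_le]; constructor <;> linarith
  have h1 := hn _ hAm
  have h2 := (abs_le.1 (abs_setIntegral_sub_le hd hAm (hfm.sub_const ε) hMε.le hgb)).2
  have hi : IntegrableOn (fun x => f x - ε) (B \ G) (μs n) :=
    Measure.integrableOn_of_bounded (measure_ne_top _ _)
      (hfm.sub_const ε).aestronglyMeasurable ((ae_restrict_mem hAm).mono hgb)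
  have h3 := setIntegral_mono_on (hF n).integrableOn hi hAm fun x hx => hx.1
  have h4 : ∫ x in B \ G, (f x - ε) ∂μ = ∫ x in B \ G, f x ∂μ - μ.real (B \ G) * ε := by
    rw [integral_sub hf.integrableOn (integrable_const _).integrableOn, setIntegral_const,
      smul_eq_mul]
  have h5 : 2 * (M + ε) * (ε * η / (16 * (M + ε))) = ε * η / 8 := by
    field_simp; norm_num
  have h6 : μ.real B ≤ μ.real (B \ G) + μ.real G :=
    (measureReal_mono (by rw [Set.sdiff_union_self]; exact Set.subset_union_left)).trans
      (measureReal_union_le _ _)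
  have h7 : μ.real (B \ G) ≤ η / 4 := by
    refine le_of_mul_le_mul_right ?_ hε
    linarith
  rw [Real.dist_eq, sub_zero, abs_of_nonneg ENNReal.toReal_nonneg]
  change μ.real B < η
  linarith

lemma eventually_forall_neg_le_setIntegral_sublevel
    (htv : ∀ d : ℝ, 0 < d → ∀ᶠ n in atTop, ∀ A, MeasurableSet A →
      |(μs n).real A - μ.real A| ≤ d)
    (hf : Integrable f μ)
    (hF : ∀ n, Integrable (F n) (μs n)) (hFm : ∀ n, Measurable (F n))
    (h : ∀ ε : ℝ, 0 < ε → ∀ᶠ n in atTop, ∀ A, MeasurableSet A →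
      -ε ≤ ∫ x in A, F n x ∂μs n - ∫ x in A, f x ∂μ) {ε : ℝ} (hε : 0 < ε) :
    ∀ᶠ K : ℝ in atTop, ∀ n, -ε ≤ ∫ x in {x | F n x ≤ -K}, F n x ∂μs n := by
  obtain ⟨δ, hδ, H⟩ := exists_pos_abs_setIntegral_lt hf (half_pos hε)
  obtain ⟨N, hN⟩ := eventually_atTop.1 ((h _ (half_pos hε)).and (htv _ (half_pos hδ)))
  have hsmall : ∀ᶠ K : ℝ in atTop, ∀ n ∈ Finset.range N,
      -ε ≤ ∫ x in {x | F n x ≤ -K}, F n x ∂μs n :=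
    (Finset.eventually_all _).2 fun n _ => eventually_neg_le_setIntegral_sublevel (hF n) hε
  filter_upwards [hsmall, eventually_gt_atTop ((ε / 2 + ∫ x, |f x| ∂μ) / (δ / 2)),
    eventually_gt_atTop 0] with K hK hK1 hK0 n
  by_cases hn : n < N
  · exact hK n (Finset.mem_range.2 hn)
  obtain ⟨hn1, hn2⟩ := hN n (not_lt.1 hn)
  have hAm : MeasurableSet {x | F n x ≤ -K} := measurableSet_le (hFm n) measurable_const
  have h1 := hn1 _ hAm
  have h2 := (abs_le.1 (hn2 _ hAm)).1
  have h3 := (abs_le.1 (abs_setIntegral_le_integral_abs hf {x | F n x ≤ -K})).1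
  have h4 := mul_measureReal_le_neg_setIntegral (hF n) (hFm n) K
  rw [div_lt_iff₀ (half_pos hδ)] at hK1
  have h5 : (μs n).real {x | F n x ≤ -K} < δ / 2 := by
    refine lt_of_mul_lt_mul_left ?_ hK0.le
    linarith
  have h6 := (abs_lt.1 (H {x | F n x ≤ -K} (by linarith))).1
  linarith

lemma eventually_setIntegral_sub_ge
    (htv : ∀ d : ℝ, 0 < d → ∀ᶠ n in atTop, ∀ A, MeasurableSet A →
      |(μs n).real A - μ.real A| ≤ d)
    (hf : Integrable f μ) (hfm : Measurable f)
    (hF : ∀ n, Integrable (F n) (μs n)) (hFm : ∀ n, Measurable (F n))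
    (h1 : ∀ ε : ℝ, 0 < ε → Tendsto (fun n => μ {x | F n x ≤ f x - ε}) atTop (𝓝 0))
    (h2 : ∀ ε : ℝ, 0 < ε → ∃ K₀ : ℝ, ∀ K ≥ K₀, ∀ n,
      -ε ≤ ∫ x in {x | F n x ≤ -K}, F n x ∂μs n) {ε : ℝ} (hε : 0 < ε) :
    ∀ᶠ n in atTop, ∀ A, MeasurableSet A →
      -ε ≤ ∫ x in A, F n x ∂μs n - ∫ x in A, f x ∂μ := by
  obtain ⟨η, hη, rfl⟩ : ∃ η > 0, 5 * η = ε := ⟨ε / 5, by positivity, by ring⟩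
  obtain ⟨K₀, hK₀⟩ := h2 η hη
  obtain ⟨K, hK, hK0⟩ : ∃ K ≥ K₀, 0 < K := ⟨max K₀ 1, le_max_left _ _, by positivity⟩
  obtain ⟨δ, hδ, H⟩ := exists_pos_abs_setIntegral_lt hf hη
  set κ := min δ (η / (2 * K)) with hκ
  have hκ0 : 0 < κ := lt_min hδ (by positivity)
  obtain ⟨M, hM, hM0⟩ := ((eventually_measureReal_lt_abs_lt hf (half_pos hκ0)).and
    (eventually_gt_atTop 0)).exists
  set m := μ.real Set.univ with hm
  have hm0 : 0 ≤ m := measureReal_nonneg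
  have hγ : 0 < η / (m + 1) := by positivity
  set γ := η / (m + 1) with hγdef
  have hB0 : ∀ᶠ n in atTop, μ.real {x | F n x ≤ f x - γ} < κ / 2 := by
    have := (ENNReal.tendsto_toReal_iff (fun n => measure_ne_top μ _) ENNReal.zero_ne_top).2
      (h1 γ hγ)
    exact this.eventually (gt_mem_nhds (by simpa using hκ0))
  filter_upwards [hB0, htv 1 one_pos, htv (η / (2 * K)) (by positivity),
    htv (η / (2 * M)) (by positivity)] with n hB hd1 hdK hdM A hA
  set B := {x | F n x ≤ f x - γ} with hBdef
  have hBm : MeasurableSet B := measurableSet_le (hFm n) (hfm.sub_const γ)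
  set G := {x | M < |f x|} with hG
  have hGm : MeasurableSet G := measurableSet_lt measurable_const hfm.abs
  have hEm : MeasurableSet (B ∪ G) := hBm.union hGm
  set L := {x | F n x ≤ -K} with hL
  have hLm : MeasurableSet L := measurableSet_le (hFm n) measurable_const
  have hE : μ.real (B ∪ G) < κ := (measureReal_union_le _ _).trans_lt (by linarith)
  have i1 := integral_inter_add_sdiff hEm ((hF n).integrableOn (s := A))
  have i2 := integral_inter_add_sdiff hEm (hf.integrableOn (s := A))
  have i3 := integral_inter_add_sdiff hLm ((hF n).integrableOn (s := A ∩ (B ∪ G)))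
  have b1 : -η ≤ ∫ x in A ∩ (B ∪ G) ∩ L, F n x ∂μs n := by
    have j := integral_inter_add_sdiff (hA.inter hEm) ((hF n).integrableOn (s := L))
    have j2 : ∫ x in L \ (A ∩ (B ∪ G)), F n x ∂μs n ≤ 0 :=
      setIntegral_nonpos (hLm.diff (hA.inter hEm)) fun x hx => by
        have : F n x ≤ -K := hx.1
        linarith
    rw [Set.inter_comm L] at j
    have j3 := hK₀ K hK n
    linarith
  have b2 : -η ≤ ∫ x in (A ∩ (B ∪ G)) \ L, F n x ∂μs n := by
    have j := setIntegral_mono_on (μ := μs n) (f := fun _ => -K) (g := F n)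
      (s := (A ∩ (B ∪ G)) \ L) (integrable_const _).integrableOn (hF n).integrableOn
      ((hA.inter hEm).diff hLm) fun x hx => (not_le.1 hx.2).le
    rw [setIntegral_const, smul_eq_mul] at j
    have j2 : (μs n).real ((A ∩ (B ∪ G)) \ L) ≤ (μs n).real (B ∪ G) :=
      measureReal_mono fun x hx => hx.1.2
    have j3 := (abs_le.1 (hdK _ hEm)).2
    have j4 : κ ≤ η / (2 * K) := min_le_right _ _
    have j5 : (μs n).real ((A ∩ (B ∪ G)) \ L) * K ≤ 2 * (η / (2 * K)) * K :=
      mul_le_mul_of_nonneg_right (by linarith) hK0.le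
    have j6 : 2 * (η / (2 * K)) * K = η := by field_simp
    linarith
  have b3 : ∫ x in A ∩ (B ∪ G), f x ∂μ ≤ η :=
    (abs_lt.1 (H _ ((measureReal_mono Set.inter_subset_right).trans_lt
      (hE.trans_le (min_le_left _ _))))).2.le
  have hAE := hA.diff hEm
  have hfb : ∀ x ∈ A \ (B ∪ G), |f x| ≤ M := fun x hx => not_lt.1 fun h => hx.2 (Or.inr h)
  have hfi : IntegrableOn f (A \ (B ∪ G)) (μs n) :=
    Measure.integrableOn_of_bounded (measure_ne_top _ _)
      hfm.aestronglyMeasurable ((ae_restrict_mem hAE).mono hfb)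
  have hci : IntegrableOn (fun _ => γ) (A \ (B ∪ G)) (μs n) := (integrable_const _).integrableOn
  have b4 := (abs_le.1 (abs_setIntegral_sub_le hdM hAE hfm hM0.le hfb)).1
  have b5 := setIntegral_mono_on (hfi.sub hci) (hF n).integrableOn hAE fun x hx =>
    (not_le.1 fun h => hx.2 (Or.inl h)).le
  simp only [Pi.sub_apply] at b5
  rw [integral_sub hfi hci, setIntegral_const, smul_eq_mul] at b5
  have b6 : (μs n).real (A \ (B ∪ G)) ≤ m + 1 := by
    have j := (abs_le.1 (hd1 _ MeasurableSet.univ)).2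
    have j2 : (μs n).real (A \ (B ∪ G)) ≤ (μs n).real Set.univ :=
      measureReal_mono (Set.subset_univ _)
    linarith
  have b7 : (μs n).real (A \ (B ∪ G)) * γ ≤ η :=
    (mul_le_mul_of_nonneg_right b6 hγ.le).trans_eq (by rw [hγdef]; field_simp)
  have b8 : 2 * M * (η / (2 * M)) = η := by field_simp
  linarith

end Sequences

lemma SignedMeasure.apply_eq_setIntegral_rnDeriv [IsFiniteMeasure μ] {σ : SignedMeasure S}
    (h : σ ≪ᵥ μ.toENNRealVectorMeasure) {A : Set S} (hA : MeasurableSet A) :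
    σ A = ∫ x in A, σ.rnDeriv μ x ∂μ := by
  rw [← withDensityᵥ_apply (SignedMeasure.integrable_rnDeriv σ μ) hA,
    SignedMeasure.withDensityᵥ_rnDeriv_eq σ μ h]

lemma SignedMeasure.abs_apply_le_integral_abs_rnDeriv [IsFiniteMeasure μ] {σ : SignedMeasure S}
    (h : σ ≪ᵥ μ.toENNRealVectorMeasure) (A : Set S) : |σ A| ≤ ∫ x, |σ.rnDeriv μ x| ∂μ := by
  by_cases hA : MeasurableSet A
  · rw [apply_eq_setIntegral_rnDeriv h hA]
    exact abs_setIntegral_le_integral_abs (SignedMeasure.integrable_rnDeriv σ μ) A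
  · rw [σ.not_measurable hA, abs_zero]
    exact integral_nonneg fun _ => abs_nonneg _

end Auxiliary

/-- Uniform Fatou's Lemma for signed measures and their Radon–Nikodym derivatives. -/
theorem uniform_fatou_stmt15 {S : Type*} [MeasurableSpace S]
    (μs : ℕ → Measure S) (μ : Measure S) [∀ n, IsFiniteMeasure (μs n)]
    (htv : Tendsto (fun n => ⨆ (A : Set S) (_ : MeasurableSet A),
      (μs n A - μ A) + (μ A - μs n A)) atTop (𝓝 0))
    (τs : ℕ → SignedMeasure S) (τ : SignedMeasure S)
    (hac : τ ≪ᵥ μ.toENNRealVectorMeasure)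
    (hacs : ∀ n, τs n ≪ᵥ (μs n).toENNRealVectorMeasure) :
    (∀ ε : ℝ, 0 < ε → ∀ᶠ n in atTop,
      -ε ≤ ⨅ (A : Set S) (_ : MeasurableSet A), (τs n A - τ A)) ↔
    ((∀ ε : ℝ, 0 < ε →
        Tendsto (fun n =>
          μ {s | (τs n).rnDeriv (μs n) s ≤ τ.rnDeriv μ s - ε}) atTop (𝓝 0)) ∧
      (∀ ε : ℝ, 0 < ε → ∃ K₀ : ℝ, ∀ K ≥ K₀, ∀ n,
        -ε ≤ τs n {s | (τs n).rnDeriv (μs n) s ≤ -K})) := by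
  have : IsFiniteMeasure μ := isFiniteMeasure_of_tendsto_totalVariation htv
  have htv' (d : ℝ) (hd : 0 < d) := eventually_abs_measureReal_sub_le htv hd
  have hf := SignedMeasure.integrable_rnDeriv τ μ
  have hfm := SignedMeasure.measurable_rnDeriv τ μ
  have hF n := SignedMeasure.integrable_rnDeriv (τs n) (μs n)
  have hFm n := SignedMeasure.measurable_rnDeriv (τs n) (μs n)
  have hW (ε : ℝ) (hε : 0 < ε) (n : ℕ) :
      (-ε ≤ ⨅ (A : Set S) (_ : MeasurableSet A), (τs n A - τ A)) ↔
        ∀ A, MeasurableSet A → -ε ≤ ∫ x in A, (τs n).rnDeriv (μs n) x ∂μs n -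
          ∫ x in A, τ.rnDeriv μ x ∂μ := by
    rw [neg_le_iInf_measurableSet_iff (C := ∫ x, |(τs n).rnDeriv (μs n) x| ∂μs n +
      ∫ x, |τ.rnDeriv μ x| ∂μ) (fun A => ?_) hε.le]
    · refine forall₂_congr fun A hA => ?_
      rw [SignedMeasure.apply_eq_setIntegral_rnDeriv hac hA,
        SignedMeasure.apply_eq_setIntegral_rnDeriv (hacs n) hA]
    · have h1 := abs_le.1 (SignedMeasure.abs_apply_le_integral_abs_rnDeriv hac A)
      have h2 := abs_le.1 (SignedMeasure.abs_apply_le_integral_abs_rnDeriv (hacs n) A)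
      linarith [h1.2, h2.1]
  have hK (K : ℝ) (n : ℕ) : τs n {s | (τs n).rnDeriv (μs n) s ≤ -K} =
      ∫ x in {s | (τs n).rnDeriv (μs n) s ≤ -K}, (τs n).rnDeriv (μs n) x ∂μs n :=
    SignedMeasure.apply_eq_setIntegral_rnDeriv (hacs n)
      (measurableSet_le (hFm n) measurable_const)
  simp only [hK]
  constructor
  · intro h
    have h' (ε : ℝ) (hε : 0 < ε) := (h ε hε).mono fun n => (hW ε hε n).1
    exact ⟨fun ε hε => tendsto_measure_of_eventually_setIntegral_sub_ge htv' hf hfm hF hFm h' hε,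
      fun ε hε => eventually_atTop.1
        (eventually_forall_neg_le_setIntegral_sublevel htv' hf hF hFm h' hε)⟩
  · rintro ⟨h1, h2⟩ ε hε
    exact (eventually_setIntegral_sub_ge htv' hf hfm hF hFm h1 h2 hε).mono
      fun n => (hW ε hε n).2
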